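/- Let θ ∈ (0,1) be fixed, p = p(n) = n^{−θ}, b = 1/(1−p), and for each n define k₀(n) = max{ k ∈ ℕ : C(n,k)·(1−p)^{k(k−1)/2} > n⁴ }, where C(n,k) is the binomial coefficient. Then for all sufficiently large n, 2·log_b(n·p) − 4·log_b(log(n·p)) ≤ k₀(n) ≤ 2·log_b(n·p); in particular k₀(n) ~ 2·log_b(n·p) as n → ∞. -/

import Mathlib

open Filter Real

theorem natCast_mul_pred_div_two (k : ℕ) :
    ((k * (k - 1) / 2 : ℕ) : ℝ) = k * (k - 1) / 2 := by
  rw [Nat.cast_div (Nat.even_mul_pred_self k).two_dvd (by norm_num)]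
  cases k <;> simp

theorem pow_le_pow_mul_choose {n k : ℕ} (h : k ≤ n) : n ^ k ≤ k ^ k * n.choose k := by
  induction k generalizing n with
  | zero => simp
  | succ k ih =>
    obtain ⟨n, rfl⟩ : ∃ m, n = m + 1 := ⟨n - 1, by omega⟩
    have hkn : k ≤ n := by omega
    have key : (n + 1) ^ k ≤ (k + 1) ^ k * n.choose k := by
      rcases Nat.eq_zero_or_pos k with rfl | hk
      · simp
      · refine Nat.le_of_mul_le_mul_right ?_ (pow_pos hk k)
        calc (n + 1) ^ k * k ^ k = ((n + 1) * k) ^ k := (mul_pow ..).symm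
          _ ≤ ((k + 1) * n) ^ k := Nat.pow_le_pow_left (by nlinarith) k
          _ = (k + 1) ^ k * n ^ k := mul_pow ..
          _ ≤ (k + 1) ^ k * (k ^ k * n.choose k) := Nat.mul_le_mul_left _ (ih hkn)
          _ = _ := by ring
    calc (n + 1) ^ (k + 1) = (n + 1) ^ k * (n + 1) := pow_succ ..
      _ ≤ (k + 1) ^ k * n.choose k * (n + 1) := Nat.mul_le_mul_right _ key
      _ = (k + 1) ^ k * ((n + 1) * n.choose k) := by ring
      _ = (k + 1) ^ (k + 1) * (n + 1).choose (k + 1) := by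
        rw [Nat.add_one_mul_choose_eq]; ring

theorem mul_log_sub_log_le_log_choose {n k : ℕ} (hk : 0 < k) (h : k ≤ n) :
    k * (log n - log k) ≤ log (n.choose k) := by
  have hn : 0 < n := by omega
  have hc : 0 < n.choose k := Nat.choose_pos h
  have h1 : ((n : ℝ) ^ k) ≤ (k : ℝ) ^ k * n.choose k := by
    exact_mod_cast pow_le_pow_mul_choose h
  have h2 := Real.log_le_log (by positivity) h1
  rw [Real.log_mul (by positivity) (by positivity), Real.log_pow, Real.log_pow] at h2
  linarith

theorem log_choose_le {n k : ℕ} (hk : 0 < k) (h : k ≤ n) :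
    log (n.choose k) ≤ k * (1 + log n - log k) := by
  have hn : 0 < n := by omega
  have hc : 0 < n.choose k := Nat.choose_pos h
  have hf : (0 : ℝ) < k.factorial := by exact_mod_cast k.factorial_pos
  have h1 : (n.choose k : ℝ) ≤ n ^ k / k.factorial := Nat.choose_le_pow_div k n
  have h2 : (k : ℝ) ^ k / k.factorial ≤ exp k := Real.pow_div_factorial_le_exp _ (by positivity) k
  have h3 := Real.log_le_log (by positivity) h1
  have h4 := Real.log_le_log (by positivity) h2
  rw [Real.log_div (by positivity) (by positivity), Real.log_pow] at h3 h4
  rw [Real.log_exp] at h4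
  linarith

theorem log_choose_mul_pow {n k : ℕ} {p : ℝ} (hp : p < 1) (h : k ≤ n) :
    log (n.choose k * (1 - p) ^ (k * (k - 1) / 2)) =
      log (n.choose k) - -log (1 - p) * (k * (k - 1) / 2) := by
  have hc : 0 < n.choose k := Nat.choose_pos h
  have : 0 < 1 - p := by linarith
  rw [Real.log_mul (by positivity) (by positivity), Real.log_pow, natCast_mul_pred_div_two]
  ring

theorem le_neg_log_one_sub {p : ℝ} (hp : p < 1) : p ≤ -log (1 - p) := by
  linarith [Real.log_le_sub_one_of_pos (sub_pos.2 hp)]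

theorem neg_log_one_sub_le {p : ℝ} (hp0 : 0 ≤ p) (hp : p ≤ 1 / 2) :
    -log (1 - p) ≤ 2 * p := by
  have h0 : 0 < 1 - p := by linarith
  have h1 := Real.one_sub_inv_le_log_of_pos h0
  have h2 : (1 - p)⁻¹ ≤ 1 + 2 * p := by
    rw [inv_le_iff_one_le_mul₀ h0]
    nlinarith
  linarith

theorem choose_mul_pow_le_one {n k : ℕ} {p : ℝ} (hn : 0 < n) (hp0 : 0 < p) (hp : p ≤ 1 / 2)
    (hL : 2 ≤ log (log (n * p))) (hL0 : 0 < log (n * p))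
    (hk : 2 * (log (n * p) / -log (1 - p)) < k) :
    n.choose k * (1 - p) ^ (k * (k - 1) / 2) ≤ 1 := by
  rcases lt_or_ge n k with h | h
  · simp [Nat.choose_eq_zero_of_lt h]
  have hβ0 := le_neg_log_one_sub (show p < 1 by linarith)
  have hβ1 := neg_log_one_sub_le hp0.le hp
  have hlog := log_choose_mul_pow (show p < 1 by linarith) h
  set β := -log (1 - p)
  set L := log (n * p) with hLdef
  have hβ : 0 < β := by linarith
  have hk0 : (0 : ℝ) < k := lt_of_le_of_lt (by positivity) hk
  have hk' : 0 < k := by exact_mod_cast hk0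
  have hc : 0 < n.choose k := Nat.choose_pos h
  have h1p : 0 < 1 - p := by linarith
  have hkL : 2 * L < k * β := by
    rwa [← mul_div_assoc, div_lt_iff₀ hβ] at hk
  have hL' : L = log n + log p := by
    rw [hLdef, Real.log_mul (by positivity) (by positivity)]
  have hlk : log L ≤ log k + log p := by
    rw [← Real.log_mul (by positivity) (by positivity)]
    exact Real.log_le_log hL0 (by nlinarith)
  rw [← Real.log_nonpos_iff (by positivity), hlog]
  have h1 := log_choose_le hk' h
  have h2 : (k : ℝ) * (1 + log n - log k) - β * (k * (k - 1) / 2) =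
      k * (1 + log n - log k - (k * β) / 2 + β / 2) := by ring
  have h3 : (k : ℝ) * (1 + log n - log k - (k * β) / 2 + β / 2) ≤ 0 :=
    mul_nonpos_of_nonneg_of_nonpos hk0.le (by linarith)
  linarith

theorem exists_lt_choose_mul_pow {n : ℕ} {p c : ℝ} (hn : 0 < n) (hp0 : 0 < p) (hp : p ≤ 1 / 2)
    (hL : 2 ≤ log (log (n * p))) (hL0 : 0 < log (n * p))
    (hLL : 4 * log (log (n * p)) ≤ log (n * p)) (hLn : 2 * log (n * p) ≤ n * p)
    (hc : c * log n ≤ log (n * p)) (hpc : 8 * p < c) :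
    ∃ k : ℕ, 2 * (log (n * p) / -log (1 - p)) - 4 * (log (log (n * p)) / -log (1 - p)) ≤ k ∧
      (n : ℝ) ^ 4 < n.choose k * (1 - p) ^ (k * (k - 1) / 2) := by
  have hβ0 := le_neg_log_one_sub (show p < 1 by linarith)
  have hβ1 := neg_log_one_sub_le hp0.le hp
  have hlog := fun k (h : k ≤ n) => log_choose_mul_pow (show p < 1 by linarith) h
  set β := -log (1 - p)
  set L := log (n * p) with hLdef
  have hβ : 0 < β := by linarith
  have hx : 2 * (L / β) - 4 * (log L / β) = (2 * L - 4 * log L) / β := by ring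
  rw [hx]
  have hx0 : 0 < (2 * L - 4 * log L) / β := div_pos (by linarith) hβ
  set k := ⌈(2 * L - 4 * log L) / β⌉₊
  have hk1 : (2 * L - 4 * log L) / β ≤ k := Nat.le_ceil _
  have hk2 : (k : ℝ) < (2 * L - 4 * log L) / β + 1 := Nat.ceil_lt_add_one hx0.le
  have hk0 : (0 : ℝ) < k := hx0.trans_le hk1
  have hk' : 0 < k := by exact_mod_cast hk0
  refine ⟨k, hk1, ?_⟩
  rw [div_le_iff₀ hβ] at hk1
  have hk3 : (k - 1) * β < 2 * L - 4 * log L := by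
    rw [← lt_div_iff₀ hβ]; linarith
  have hkp : k * p ≤ 2 * L := by nlinarith
  have hkn : k ≤ n := by
    have : (k : ℝ) ≤ n := le_of_mul_le_mul_right (hkp.trans hLn) hp0
    exact_mod_cast this
  have hch : 0 < n.choose k := Nat.choose_pos hkn
  have h1p : 0 < 1 - p := by linarith
  have hL' : L = log n + log p := by
    rw [hLdef, Real.log_mul (by positivity) (by positivity)]
  have hlk : log k + log p ≤ log 2 + log L := by
    rw [← Real.log_mul (by positivity) (by positivity),
      ← Real.log_mul (by positivity) (by positivity)]
    exact Real.log_le_log (by positivity) hkp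
  have hlog2 : log 2 < 1 := Real.log_two_lt_d9.trans (by norm_num)
  have h1 := mul_log_sub_log_le_log_choose hk' hkn
  have h2 : (k : ℝ) * (log n - log k) - β * (k * (k - 1) / 2) =
      k * (log n - log k - (k - 1) * β / 2) := by ring
  have h3 : (k : ℝ) * 1 ≤ k * (log n - log k - (k - 1) * β / 2) :=
    mul_le_mul_of_nonneg_left (by linarith) hk0.le
  have h4 : 4 * log n < k := by
    have h5 : c * (4 * log n) < c * k := by nlinarith
    exact lt_of_mul_lt_mul_left h5 (by linarith)
  rw [← Real.log_lt_log_iff (by positivity) (by positivity), hlog k hkn, Real.log_pow]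
  push_cast
  linarith

/-- For `p(n) = n^{-θ}` with `θ ∈ (0,1)` and
`k₀(n) = max{k : C(n,k)·(1−p)^{k(k−1)/2} > n⁴}`, one has
`2·log_b(np) − 4·log_b(log(np)) ≤ k₀(n) ≤ 2·log_b(np)` for all large `n`,
and in particular `k₀(n) ~ 2·log_b(np)`. -/
theorem k0_asymptotics (θ : ℝ) (hθ0 : 0 < θ) (hθ1 : θ < 1)
    (p : ℕ → ℝ) (hp : ∀ n : ℕ, p n = (n : ℝ) ^ (-θ))
    (b : ℕ → ℝ) (hb : ∀ n, b n = 1 / (1 - p n))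
    (k₀ : ℕ → ℕ)
    (hk₀ : ∀ n : ℕ, k₀ n = sSup {k : ℕ |
        (n.choose k : ℝ) * (1 - p n) ^ (k * (k - 1) / 2) > (n : ℝ) ^ 4}) :
    (∀ᶠ n : ℕ in atTop,
        2 * Real.logb (b n) (n * p n) - 4 * Real.logb (b n) (Real.log (n * p n)) ≤ (k₀ n : ℝ)
        ∧ (k₀ n : ℝ) ≤ 2 * Real.logb (b n) (n * p n))
    ∧ Tendsto (fun n => (k₀ n : ℝ) / (2 * Real.logb (b n) (n * p n))) atTop (nhds 1) := by
  have hlogb : ∀ n x, Real.logb (b n) x = log x / -log (1 - p n) := fun n x => by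
    rw [Real.logb, hb, one_div, Real.log_inv]
  simp only [hlogb]
  have hp_lim : Tendsto p atTop (nhds 0) := by
    rw [funext hp]
    exact (tendsto_rpow_neg_atTop hθ0).comp tendsto_natCast_atTop_atTop
  have hnp : ∀ n : ℕ, 0 < n → n * p n = (n : ℝ) ^ (1 - θ) := fun n hn => by
    rw [hp, sub_eq_add_neg, Real.rpow_add (by positivity), Real.rpow_one]
  have hnp_lim : Tendsto (fun n : ℕ => n * p n) atTop atTop := by
    refine ((tendsto_rpow_atTop (sub_pos.2 hθ1)).comp tendsto_natCast_atTop_atTop).congr' ?_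
    filter_upwards [eventually_gt_atTop 0] with n hn using (hnp n hn).symm
  have hL_lim : Tendsto (fun n : ℕ => log (n * p n)) atTop atTop :=
    Real.tendsto_log_atTop.comp hnp_lim
  have hlog_small : ∀ c : ℝ, 0 < c → ∀ᶠ x : ℝ in atTop, c * log x ≤ x := fun c hc => by
    filter_upwards [Real.isLittleO_log_id_atTop.bound (inv_pos.2 hc), eventually_ge_atTop 0]
      with x hx hx0
    rw [id, Real.norm_of_nonneg hx0, inv_mul_eq_div, le_div_iff₀' hc] at hx
    exact (mul_le_mul_of_nonneg_left (le_abs_self _) hc.le).trans hx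
  have hbounds : ∀ᶠ n : ℕ in atTop,
      2 * (log (n * p n) / -log (1 - p n)) - 4 * (log (log (n * p n)) / -log (1 - p n)) ≤ (k₀ n : ℝ)
        ∧ (k₀ n : ℝ) ≤ 2 * (log (n * p n) / -log (1 - p n)) := by
    filter_upwards [eventually_gt_atTop 0, hp_lim.eventually_lt_const (show (0 : ℝ) < 1 / 2 by simp),
      hp_lim.eventually_lt_const (show (0 : ℝ) < (1 - θ) / 8 by linarith),
      (Real.tendsto_log_atTop.comp hL_lim).eventually_ge_atTop 2,
      hL_lim.eventually_gt_atTop 0, hL_lim.eventually (hlog_small 4 (by norm_num)),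
      hnp_lim.eventually (hlog_small 2 (by norm_num))] with n hn hp1 hp2 hLL hL h4 h2
    have hp0 : 0 < p n := by rw [hp]; positivity
    have hupper : ∀ k : ℕ, (n : ℝ) ^ 4 < n.choose k * (1 - p n) ^ (k * (k - 1) / 2) →
        (k : ℝ) ≤ 2 * (log (n * p n) / -log (1 - p n)) := fun k hk => by
      by_contra! hlt
      have h1 : (1 : ℝ) ≤ (n : ℝ) ^ 4 := one_le_pow₀ (by exact_mod_cast hn)
      linarith [choose_mul_pow_le_one hn hp0 hp1.le hLL hL hlt]
    obtain ⟨k, hk, hkmem⟩ := exists_lt_choose_mul_pow (c := 1 - θ) hn hp0 hp1.le hLL hL h4 h2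
      (by rw [hnp n hn, Real.log_rpow (by positivity)]) (by linarith)
    have hbdd : BddAbove {k : ℕ |
        (n.choose k : ℝ) * (1 - p n) ^ (k * (k - 1) / 2) > (n : ℝ) ^ 4} :=
      ⟨⌊2 * (log (n * p n) / -log (1 - p n))⌋₊, fun j hj => Nat.le_floor (hupper j hj)⟩
    rw [hk₀]
    exact ⟨hk.trans (by exact_mod_cast le_csSup hbdd hkmem),
      hupper _ (Nat.sSup_mem ⟨k, hkmem⟩ hbdd)⟩
  refine ⟨hbounds, ?_⟩
  have hlow : Tendsto (fun n : ℕ => 1 - 2 * (log (log (n * p n)) / log (n * p n))) atTop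
      (nhds 1) := by
    have := (Real.isLittleO_log_id_atTop.tendsto_div_nhds_zero.comp hL_lim).const_mul 2
    simpa using this.const_sub 1
  have hpos : ∀ᶠ n : ℕ in atTop, 0 < log (n * p n) ∧ 0 < -log (1 - p n) := by
    filter_upwards [eventually_gt_atTop 0, hL_lim.eventually_gt_atTop 0,
      hp_lim.eventually_lt_const one_pos] with n hn hL hp1
    have hp0 : 0 < p n := by rw [hp]; positivity
    exact ⟨hL, hp0.trans_le (le_neg_log_one_sub hp1)⟩
  refine tendsto_of_tendsto_of_tendsto_of_le_of_le' hlow tendsto_const_nhds ?_ ?_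
  · filter_upwards [hbounds, hpos] with n hn ⟨hL, hβ⟩
    rw [le_div_iff₀ (by positivity)]
    refine le_trans (le_of_eq ?_) hn.1
    generalize -log (1 - p n) = β at hβ ⊢
    field_simp
    ring
  · filter_upwards [hbounds, hpos] with n hn ⟨hL, hβ⟩
    exact div_le_one_of_le₀ hn.2 (by positivity)
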